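/- Every positive congruence is the kernel of a positive homomorphism: let L_⊑ be a naturally ordered finite distributive lattice and let f : L → K be a surjective {0,1}-lattice homomorphism onto a finite distributive lattice K whose kernel is positive, i.e. for all a, b ∈ L with f(a) ≠ f(b), either c − N(f) ⊑ d − N(f) for all c, d ∈ L with f(c) = f(a) and f(d) = f(b), or d − N(f) ⊑ c − N(f) for all such c, d. Then there exists a natural linear order ≼ on K such that f : L_⊑ → K_≼ is a positive homomorphism. -/

import Mathlib

open Function

/-- An element of a lattice with least element `⊥` is join-irreducible if it is not `⊥`
and `j = a ⊔ b` implies `j = a` or `j = b`. -/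
def JoinIrred {L : Type*} [Lattice L] [OrderBot L] (j : L) : Prop :=
  j ≠ ⊥ ∧ ∀ a b : L, j = a ⊔ b → j = a ∨ j = b

/-- `latN f` is the set `N(f) = {x | ∃ y, y < x ∧ f y = f x}`. -/
def latN {L K : Type*} [Preorder L] (f : L → K) : Set L :=
  {x | ∃ y, y < x ∧ f y = f x}

open Classical in
/-- `minus x S` is `x − S`: the join of the set of join-irreducibles `j` with
`j ≤ x` and `j ∉ S` (the empty join being `⊥`). -/
noncomputable def minus {L : Type*} [Lattice L] [OrderBot L] [Fintype L]
    (x : L) (S : Set L) : L :=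
  (Finset.univ.filter fun j : L => JoinIrred j ∧ j ≤ x ∧ j ∉ S).sup id

/-- A `{0,1}`-lattice homomorphism: a map preserving `⊔`, `⊓`, `⊥` and `⊤`. -/
def IsBddLatticeHom {L K : Type*} [Lattice L] [BoundedOrder L] [Lattice K] [BoundedOrder K]
    (f : L → K) : Prop :=
  (∀ x y : L, f (x ⊔ y) = f x ⊔ f y) ∧ (∀ x y : L, f (x ⊓ y) = f x ⊓ f y) ∧
    f ⊥ = ⊥ ∧ f ⊤ = ⊤

/-- `r` is a natural linear order on the bounded lattice `L`: it is a (reflexive) linear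
order whose restriction to the join-irreducibles extends the lattice order, and which is
the antilexicographic order determined by this restriction: for distinct `x`, `y`,
`x` is strictly below `y` iff the `r`-greatest join-irreducible `j` for which exactly one
of `j ≤ x`, `j ≤ y` holds satisfies `j ≤ y`. -/
def IsNaturalOrder {L : Type*} [Lattice L] [BoundedOrder L] (r : L → L → Prop) : Prop :=
  IsLinearOrder L r ∧
  (∀ j j' : L, JoinIrred j → JoinIrred j' → j ≤ j' → r j j') ∧
  ∀ x y : L, x ≠ y →
    (r x y ↔ ∃ j : L, JoinIrred j ∧ j ≤ y ∧ ¬ j ≤ x ∧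
      ∀ j' : L, JoinIrred j' → ¬ ((j' ≤ x) ↔ (j' ≤ y)) → r j' j)

/-- A homomorphism `f : L → K` between lattices carrying linear orders `rL`, `rK`
is positive if `x − N(f) ⊑ y − N(f)` implies `f x ≼ f y`. -/
def IsPositive {L K : Type*} [Lattice L] [OrderBot L] [Fintype L]
    (rL : L → L → Prop) (rK : K → K → Prop) (f : L → K) : Prop :=
  ∀ x y : L, rL (minus x (latN f)) (minus y (latN f)) → rK (f x) (f y)

open Classical in
/-- The Birkhoff dual of a `{0,1}`-lattice homomorphism: `J(f)(y) = ⋀ {x | f x ≥ y}`. -/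
noncomputable def birkhoffDual {L K : Type*} [Lattice L] [OrderTop L] [Fintype L] [Preorder K]
    (f : L → K) (y : K) : L :=
  (Finset.univ.filter fun x : L => y ≤ f x).inf id

/-- The kernel of `f` is a positive congruence: any two distinct kernel classes are
uniformly comparable via `· − N(f)` in the order `rL`. -/
def KernelPositive {L K : Type*} [Lattice L] [OrderBot L] [Fintype L]
    (rL : L → L → Prop) (f : L → K) : Prop :=
  ∀ a b : L, f a ≠ f b →
    (∀ c d : L, f c = f a → f d = f b → rL (minus c (latN f)) (minus d (latN f))) ∨
    (∀ c d : L, f c = f a → f d = f b → rL (minus d (latN f)) (minus c (latN f)))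

theorem joinIrred_iff_supIrred {L : Type*} [Lattice L] [OrderBot L] {j : L} :
    JoinIrred j ↔ SupIrred j := by
  simp only [JoinIrred, SupIrred, isMin_iff_eq_bot, ne_eq, @eq_comm L j]

namespace IsBddLatticeHom

variable {L K : Type*} [Lattice L] [BoundedOrder L] [Lattice K] [BoundedOrder K] {f : L → K}

theorem monotone (hf : IsBddLatticeHom f) : Monotone f := fun x y h => by
  rw [← sup_eq_right, ← hf.1, sup_eq_right.mpr h]

theorem gc_birkhoffDual [Fintype L] (hf : IsBddLatticeHom f) :
    GaloisConnection (birkhoffDual f) f := by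
  classical
  intro k x
  refine ⟨fun h => le_trans ?_ (hf.monotone h), fun h => ?_⟩
  · refine Finset.inf_induction (p := fun x => k ≤ f x) ?_ ?_ ?_
    · rw [hf.2.2.2]
      exact le_top
    · intro a ha b hb
      rw [hf.2.1]
      exact le_inf ha hb
    · simp
  · exact Finset.inf_le (f := id) (by simpa using h)

end IsBddLatticeHom

namespace GaloisConnection

variable {L K : Type*} [DistribLattice L] [BoundedOrder L] [DistribLattice K] [BoundedOrder K]
  {f : L → K} {g : K → L}

theorem l_finset_sup (gc : GaloisConnection g f) (s : Finset K) : g (s.sup id) = s.sup g :=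
  Finset.apply_sup_eq_sup_comp g (fun _ _ => gc.l_sup) gc.l_bot

theorem supIrred_l (gc : GaloisConnection g f) (hf : IsBddLatticeHom f) {k : K}
    (hk : SupIrred k) : SupIrred (g k) := by
  rw [← supPrime_iff_supIrred] at hk ⊢
  refine ⟨fun h => hk.1 ?_, fun {a b} h => ?_⟩
  · rw [isMin_iff_eq_bot] at h ⊢
    rw [← le_bot_iff, ← hf.2.2.1, ← gc k, h]
  · rw [gc k, hf.1] at h
    simpa only [gc k _] using hk.2 h

theorem exists_supIrred_le_l [Finite K] (gc : GaloisConnection g f) {j : L} (hj : SupIrred j)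
    {k : K} (h : j ≤ g k) : ∃ i, SupIrred i ∧ i ≤ k ∧ j ≤ g i := by
  obtain ⟨s, rfl, hs⟩ := exists_supIrred_decomposition k
  rw [gc.l_finset_sup, (supPrime_iff_supIrred.mpr hj).le_finset_sup] at h
  obtain ⟨i, hi, hji⟩ := h
  exact ⟨i, hs hi, Finset.le_sup (f := id) hi, hji⟩

theorem minus_latN [Fintype L] [Finite K] (gc : GaloisConnection g f) (hf : IsBddLatticeHom f)
    (x : L) : minus x (latN f) = g (f x) := by
  classical
  refine le_antisymm (Finset.sup_le fun j hj => ?_) ?_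
  · simp only [Finset.mem_filter, Finset.mem_univ, true_and] at hj
    obtain ⟨-, hjx, hjN⟩ := hj
    have hle : j ≤ g (f j) := by
      by_contra h
      exact hjN ⟨g (f j), lt_of_le_not_ge (gc.l_u_le j) h, gc.u_l_u_eq_u j⟩
    exact hle.trans (gc.monotone_l (hf.monotone hjx))
  · obtain ⟨s, hsx, hs⟩ := exists_supIrred_decomposition (f x)
    rw [← hsx, gc.l_finset_sup]
    refine Finset.sup_le fun i hi => Finset.le_sup (f := id) ?_
    simp only [Finset.mem_filter, Finset.mem_univ, true_and, joinIrred_iff_supIrred]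
    refine ⟨gc.supIrred_l hf (hs hi), (gc i x).mpr (hsx ▸ Finset.le_sup (f := id) hi), ?_⟩
    rintro ⟨y, hy, hfy⟩
    exact hy.not_ge ((gc i y).mpr (hfy ▸ gc.le_u_l i))

theorem isNaturalOrder_comap [Finite K] (gc : GaloisConnection g f) (hf : IsBddLatticeHom f)
    (hsurj : Surjective f) {r : L → L → Prop} (hr : IsNaturalOrder r) :
    IsNaturalOrder fun k k' => r (g k) (g k') := by
  obtain ⟨hlin, hext, hlex⟩ := hr
  have hle (a b : K) : g a ≤ g b ↔ a ≤ b := by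
    obtain ⟨x, rfl⟩ := hsurj b
    rw [gc a, gc.u_l_u_eq_u]
  have hinj : Injective g := fun a b h => le_antisymm ((hle a b).mp h.le) ((hle b a).mp h.ge)
  have hJ {i : K} (hi : JoinIrred i) : JoinIrred (g i) :=
    joinIrred_iff_supIrred.mpr (gc.supIrred_l hf (joinIrred_iff_supIrred.mp hi))
  have key {j : L} (hj : JoinIrred j) {k k' : K} (h : ¬(j ≤ g k ↔ j ≤ g k')) :
      ∃ i, JoinIrred i ∧ ¬(i ≤ k ↔ i ≤ k') ∧ j ≤ g i := by
    have aux {a b : K} (ha : j ≤ g a) (hb : ¬j ≤ g b) :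
        ∃ i, JoinIrred i ∧ i ≤ a ∧ ¬i ≤ b ∧ j ≤ g i := by
      obtain ⟨i, hi, hia, hji⟩ := gc.exists_supIrred_le_l (joinIrred_iff_supIrred.mp hj) ha
      exact ⟨i, joinIrred_iff_supIrred.mpr hi, hia,
        fun hib => hb (hji.trans (gc.monotone_l hib)), hji⟩
    by_cases hk : j ≤ g k
    · obtain ⟨i, hi, h1, h2, h3⟩ := aux hk (fun h' => h (iff_of_true hk h'))
      exact ⟨i, hi, fun h => h2 (h.mp h1), h3⟩
    · obtain ⟨i, hi, h1, h2, h3⟩ := aux (not_not.mp fun h' => h (iff_of_false hk h')) hk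
      exact ⟨i, hi, fun h => h2 (h.mpr h1), h3⟩
  refine ⟨?_, fun i i' hi hi' h => hext _ _ (hJ hi) (hJ hi') (gc.monotone_l h), ?_⟩
  · exact
      { refl := fun a => hlin.refl _
        trans := fun a b c => hlin.trans _ _ _
        antisymm := fun a b h h' => hinj (hlin.antisymm _ _ h h')
        total := fun a b => hlin.total _ _ }
  · intro k k' hne
    refine (hlex _ _ (hinj.ne hne)).trans ?_
    constructor
    · rintro ⟨j, hj, hjk', hjk, hmax⟩
      obtain ⟨i, hi, hik', hji⟩ := gc.exists_supIrred_le_l (joinIrred_iff_supIrred.mp hj) hjk'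
      rw [← joinIrred_iff_supIrred] at hi
      refine ⟨i, hi, hik', fun hik => hjk (hji.trans (gc.monotone_l hik)), fun i' hi' h => ?_⟩
      refine hlin.trans _ _ _ (hmax _ (hJ hi') ?_) (hext _ _ hj (hJ hi) hji)
      rwa [hle, hle]
    · rintro ⟨i, hi, hik', hik, hmax⟩
      refine ⟨g i, hJ hi, (hle _ _).mpr hik', fun h => hik ((hle _ _).mp h), fun j hj h => ?_⟩
      obtain ⟨i', hi', hd, hji⟩ := key hj h
      exact hlin.trans _ _ _ (hext _ _ hj (hJ hi') hji) (hmax _ hi' hd)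

end GaloisConnection

/-- every positive congruence is the kernel of a positive homomorphism:
if the kernel of a surjective `{0,1}`-lattice homomorphism `f : L → K` is positive,
then there exists a natural linear order `≼` on `K` making `f` a positive homomorphism. -/
theorem kernelPositive_gives_positive_hom {L K : Type*}
    [DistribLattice L] [Fintype L] [BoundedOrder L]
    [DistribLattice K] [Fintype K] [BoundedOrder K]
    (rL : L → L → Prop) (hL : IsNaturalOrder rL)
    (f : L → K) (hf : IsBddLatticeHom f) (hsurj : Function.Surjective f)
    (hker : KernelPositive rL f) :
    ∃ rK : K → K → Prop, IsNaturalOrder rK ∧ IsPositive rL rK f := by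
  have gc := hf.gc_birkhoffDual
  refine ⟨_, gc.isNaturalOrder_comap hf hsurj hL, fun x y h => ?_⟩
  rwa [gc.minus_latN hf, gc.minus_latN hf] at h
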